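/- arXiv:1108.6032 — 4 statements merged into one kernel-verified Lean document; each statement's English description precedes it below -/
import Mathlib

section
/- Let θ ≥ 1 with α = 1/θ, let d ∈ ℕ with d ≥ 2, and u = (u_1,…,u_d) ∈ (0,1)^d. Let ψ_θ(t) = exp(-t^α) be the Gumbel generator with inverse ψ_θ^{-1}(u) = (-log u)^θ, set t_θ(u) = ∑_{j=1}^d (-log u_j)^θ, and for 1 ≤ k ≤ d let a^G_{dk}(θ) = (1/k!)·∑_{j=1}^{k} (k choose j)·(-1)^{d-j}·∏_{i=0}^{d-1}(α·j - i). Then (-1)^d · ψ_θ^{(d)}(t_θ(u)) · ∏_{j=1}^d (-(ψ_θ^{-1})'(u_j)) = θ^d · exp(-t_θ(u)^{1/θ}) · (∏_{j=1}^d (-log u_j)^{θ-1}) / (t_θ(u)^d · ∏_{j=1}^d u_j) · ∑_{k=1}^{d} a^G_{dk}(θ) · t_θ(u)^{k/θ}. -/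
open Finset in
/-- The coefficient of `x ^ k` in `t ^ d * exp x * (d / dt) ^ d exp (-x)`, for `x = t ^ α`. -/
noncomputable def expNegRpowCoeff (α : ℝ) (d k : ℕ) : ℝ :=
  (1 / (k.factorial : ℝ)) * ∑ j ∈ range (k + 1),
    (k.choose j : ℝ) * (-1) ^ j * ∏ i ∈ range d, (α * j - i)

namespace expNegRpowCoeff

open Finset

theorem zero_right_succ (α : ℝ) (d : ℕ) : expNegRpowCoeff α (d + 1) 0 = 0 := by
  simp [expNegRpowCoeff, prod_range_succ']

theorem zero_zero (α : ℝ) : expNegRpowCoeff α 0 0 = 1 := by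
  simp [expNegRpowCoeff]

theorem zero_right_rec (α : ℝ) (d : ℕ) :
    expNegRpowCoeff α (d + 1) 0 = (α * (0 : ℕ) - d) * expNegRpowCoeff α d 0 := by
  simp [expNegRpowCoeff, prod_range_succ, mul_comm]

theorem succ_succ (α : ℝ) (d k : ℕ) :
    expNegRpowCoeff α (d + 1) (k + 1) =
      (α * (k + 1 : ℕ) - d) * expNegRpowCoeff α d (k + 1) - α * expNegRpowCoeff α d k := by
  have hk : (k.factorial : ℝ) ≠ 0 := by positivity
  have hk' : (k + 1 : ℝ) ≠ 0 := by positivity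
  have key : ∑ j ∈ range (k + 2), ((k + 1).choose j : ℝ) * (-1) ^ j *
        ∏ i ∈ range (d + 1), (α * j - i) =
      (α * (k + 1 : ℕ) - d) * ∑ j ∈ range (k + 2), ((k + 1).choose j : ℝ) * (-1) ^ j *
        ∏ i ∈ range d, (α * j - i) -
      α * (k + 1) * ∑ j ∈ range (k + 1), (k.choose j : ℝ) * (-1) ^ j *
        ∏ i ∈ range d, (α * j - i) := by
    have hext : ∑ j ∈ range (k + 1), (k.choose j : ℝ) * (-1) ^ j *
        ∏ i ∈ range d, (α * j - i) = ∑ j ∈ range (k + 2), (k.choose j : ℝ) * (-1) ^ j *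
        ∏ i ∈ range d, (α * j - i) := by
      rw [sum_range_succ _ (k + 1)]
      simp
    rw [hext, mul_sum, mul_sum, ← sum_sub_distrib]
    refine sum_congr rfl fun j hj => ?_
    have hjk : j ≤ k + 1 := by simpa [Nat.lt_succ_iff] using hj
    have h : ((k + 1).choose j : ℝ) * (k + 1 - j) = k.choose j * (k + 1) := by
      have := Nat.choose_mul_succ_eq k j
      rw [← Nat.cast_inj (R := ℝ)] at this
      push_cast [Nat.cast_sub hjk] at this
      linarith
    rw [prod_range_succ]
    push_cast
    linear_combination (-α * (-1) ^ j * ∏ i ∈ range d, (α * j - i)) * h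
  unfold expNegRpowCoeff
  rw [key, Nat.factorial_succ]
  push_cast
  field_simp

theorem eq_zero_of_lt (α : ℝ) {d k : ℕ} (h : d < k) : expNegRpowCoeff α d k = 0 := by
  induction d generalizing k with
  | zero =>
    have := add_pow (-1 : ℝ) 1 k
    simp only [neg_add_cancel, zero_pow h.ne', one_pow, mul_one] at this
    simp [expNegRpowCoeff, mul_comm _ ((-1 : ℝ) ^ _), ← this]
  | succ d ih =>
    obtain ⟨k, rfl⟩ := Nat.exists_eq_succ_of_ne_zero (Nat.ne_zero_of_lt h)
    rw [Nat.succ_eq_add_one, succ_succ, ih (by lia), ih (by lia)]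
    ring

theorem sum_succ (α x : ℝ) (d : ℕ) :
    ∑ k ∈ range (d + 2), expNegRpowCoeff α (d + 1) k * x ^ k =
      ∑ k ∈ range (d + 1), expNegRpowCoeff α d k * ((α * k - d) * x ^ k - α * x ^ (k + 1)) := by
  have hlast : ∑ k ∈ range (d + 1), expNegRpowCoeff α d k * ((α * k - d) * x ^ k) =
      ∑ k ∈ range (d + 2), expNegRpowCoeff α d k * ((α * k - d) * x ^ k) := by
    rw [sum_range_succ _ (d + 1), eq_zero_of_lt α d.lt_succ_self]
    ring
  simp only [mul_sub _ (_ * x ^ _), sum_sub_distrib]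
  rw [hlast, sum_range_succ', sum_range_succ' _ (d + 1), zero_right_rec, add_sub_right_comm,
    ← sum_sub_distrib]
  congr 1
  · refine sum_congr rfl fun k _ => ?_
    rw [succ_succ]
    ring
  · ring

end expNegRpowCoeff

theorem hasDerivAt_exp_neg_rpow_mul_pow_div (α : ℝ) (n k : ℕ) {t : ℝ} (ht : 0 < t) :
    HasDerivAt (fun s : ℝ => Real.exp (-s ^ α) * ((s ^ α) ^ k / s ^ n))
      (Real.exp (-t ^ α) *
        (((α * k - n) * (t ^ α) ^ k - α * (t ^ α) ^ (k + 1)) / t ^ (n + 1))) t := by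
  have hx : HasDerivAt (fun s : ℝ => s ^ α) (α * t ^ α / t) t := by
    convert Real.hasDerivAt_rpow_const (p := α) (Or.inl ht.ne') using 1
    rw [Real.rpow_sub_one ht.ne', mul_div_assoc]
  have h := hx.fun_neg.exp.fun_mul ((hx.fun_pow k).fun_div (hasDerivAt_pow n t) (by positivity))
  refine h.congr_deriv ?_
  generalize t ^ α = x
  have e1 : (k : ℝ) * x ^ (k - 1) * x = k * x ^ k := by
    cases k <;> simp [pow_succ, mul_assoc]
  have e2 : (n : ℝ) * t ^ (n - 1) = n * t ^ n / t := by
    cases n <;> simp [pow_succ, mul_div_assoc, ht.ne']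
  have e3 : (k : ℝ) * x ^ (k - 1) * (α * x / t) = k * x ^ k * α / t := by
    rw [← e1]
    ring
  rw [e2, e3]
  field_simp
  ring

open Finset in
theorem iteratedDeriv_exp_neg_rpow (α : ℝ) (n : ℕ) {t : ℝ} (ht : 0 < t) :
    iteratedDeriv n (fun s : ℝ => Real.exp (-s ^ α)) t =
      Real.exp (-t ^ α) * (∑ k ∈ range (n + 1), expNegRpowCoeff α n k * (t ^ α) ^ k) / t ^ n := by
  induction n generalizing t with
  | zero => simp [expNegRpowCoeff.zero_zero]
  | succ n ih =>
    have hev : iteratedDeriv n (fun s : ℝ => Real.exp (-s ^ α)) =ᶠ[nhds t]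
        fun s => ∑ k ∈ range (n + 1),
          expNegRpowCoeff α n k * (Real.exp (-s ^ α) * ((s ^ α) ^ k / s ^ n)) := by
      filter_upwards [lt_mem_nhds ht] with s hs
      rw [ih hs, mul_sum, sum_div]
      exact sum_congr rfl fun k _ => by ring
    have hd := HasDerivAt.fun_sum (u := range (n + 1)) fun k _ =>
      (hasDerivAt_exp_neg_rpow_mul_pow_div α n k ht).const_mul (expNegRpowCoeff α n k)
    rw [iteratedDeriv_succ, hev.deriv_eq, hd.deriv, expNegRpowCoeff.sum_succ, mul_sum, sum_div]
    exact sum_congr rfl fun k _ => by ring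

theorem deriv_neg_log_rpow (θ : ℝ) {v : ℝ} (hv : v ∈ Set.Ioo (0 : ℝ) 1) :
    deriv (fun v => (-Real.log v) ^ θ) v = -(θ * (-Real.log v) ^ (θ - 1) / v) := by
  have hlog : 0 < -Real.log v := neg_pos.2 (Real.log_neg hv.1 hv.2)
  rw [((Real.hasDerivAt_log hv.1.ne').fun_neg.rpow_const (Or.inl hlog.ne')).deriv]
  ring


/-- Closed form of the d-dimensional Gumbel copula density: with
`ψ_θ(t) = exp(-t^α)`, `α = 1/θ`, `ψ_θ^{-1}(u) = (-log u)^θ`,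
`t_θ(u) = ∑_j (-log u_j)^θ` and the coefficients
`a^G_{dk}(θ) = (1/k!) ∑_{j=1}^k (k choose j)(-1)^{d-j} ∏_{i=0}^{d-1}(αj - i)`,
one has
`(-1)^d ψ_θ^{(d)}(t_θ(u)) ∏_j (-(ψ_θ^{-1})'(u_j))
   = θ^d exp(-t_θ(u)^{1/θ}) (∏_j (-log u_j)^{θ-1}) / (t_θ(u)^d ∏_j u_j)
       · ∑_{k=1}^d a^G_{dk}(θ) t_θ(u)^{k/θ}`. -/
theorem gumbel_copula_density (θ : ℝ) (hθ : 1 ≤ θ) (α : ℝ) (hα : α = 1 / θ)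
    (d : ℕ) (hd : 2 ≤ d) (u : Fin d → ℝ) (hu : ∀ j, u j ∈ Set.Ioo (0 : ℝ) 1)
    (ψ ψinv : ℝ → ℝ)
    (hψ : ∀ t : ℝ, ψ t = Real.exp (-(t ^ α)))
    (hψinv : ∀ v : ℝ, ψinv v = (-Real.log v) ^ θ)
    (t : ℝ) (ht : t = ∑ j, (-Real.log (u j)) ^ θ)
    (a : ℕ → ℝ)
    (ha : ∀ k : ℕ, a k = (1 / (Nat.factorial k : ℝ)) *
        ∑ j ∈ Finset.Icc 1 k, (Nat.choose k j : ℝ) * (-1 : ℝ) ^ ((d : ℤ) - (j : ℤ)) *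
          ∏ i ∈ Finset.range d, (α * (j : ℝ) - (i : ℝ))) :
    (-1 : ℝ) ^ d * iteratedDeriv d ψ t * ∏ j, (-(deriv ψinv (u j))) =
      θ ^ d * Real.exp (-(t ^ (1 / θ))) *
        (∏ j, (-Real.log (u j)) ^ (θ - 1)) / (t ^ d * ∏ j, u j) *
        ∑ k ∈ Finset.Icc 1 d, a k * t ^ ((k : ℝ) / θ) := by
  obtain rfl : ψ = fun s => Real.exp (-s ^ α) := funext hψ
  obtain rfl : ψinv = fun v => (-Real.log v) ^ θ := funext hψinv
  have hlog (j : Fin d) : 0 < -Real.log (u j) := neg_pos.2 (Real.log_neg (hu j).1 (hu j).2)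
  have ht0 : 0 < t := by
    rw [ht]
    exact Finset.sum_pos (fun j _ => Real.rpow_pos_of_pos (hlog j) θ)
      ⟨⟨0, by lia⟩, Finset.mem_univ _⟩
  have hprod : ∏ j, (-(deriv (fun v => (-Real.log v) ^ θ) (u j))) =
      θ ^ d * (∏ j, (-Real.log (u j)) ^ (θ - 1)) / ∏ j, u j := by
    simp only [deriv_neg_log_rpow θ (hu _), neg_neg, Finset.prod_div_distrib,
      Finset.prod_mul_distrib, Finset.prod_const, Finset.card_univ, Fintype.card_fin]
  obtain ⟨m, rfl⟩ : ∃ m, d = m + 1 := ⟨d - 1, by lia⟩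
  have hsum : ∑ k ∈ Finset.Icc 1 (m + 1), a k * t ^ ((k : ℝ) / θ) =
      (-1) ^ (m + 1) *
        ∑ k ∈ Finset.range (m + 1 + 1), expNegRpowCoeff α (m + 1) k * (t ^ α) ^ k := by
    rw [Finset.range_eq_Ico, Finset.sum_eq_sum_Ico_succ_bot (by lia),
      expNegRpowCoeff.zero_right_succ, zero_mul, zero_add, Finset.mul_sum]
    refine Finset.sum_congr rfl fun k _ => ?_
    have hpow : t ^ ((k : ℝ) / θ) = (t ^ α) ^ k := by
      rw [← Real.rpow_mul_natCast ht0.le, hα]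
      ring_nf
    have hak : a k = (-1) ^ (m + 1) * expNegRpowCoeff α (m + 1) k := by
      rw [ha, expNegRpowCoeff, Finset.range_eq_Ico (a := k + 1),
        Finset.sum_eq_sum_Ico_succ_bot (by lia), mul_left_comm]
      simp only [Finset.prod_range_succ' _ m, Nat.cast_zero, mul_zero, sub_zero, zero_add]
      congr 1
      rw [Finset.mul_sum]
      refine Finset.sum_congr rfl fun j _ => ?_
      have hsign : (-1 : ℝ) ^ (((m + 1 : ℕ) : ℤ) - (j : ℤ)) = (-1) ^ (m + 1) * (-1) ^ j := by
        rw [zpow_sub₀ (by norm_num), zpow_natCast, zpow_natCast, div_eq_mul_inv, ← inv_pow]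
        norm_num
      rw [hsign]
      ring
    rw [hpow, hak, mul_assoc]
  rw [hprod, hsum, iteratedDeriv_exp_neg_rpow α _ ht0, ← hα]
  field_simp
end

section
/- Let θ ≥ 1 with α = 1/θ, let d ∈ ℕ with d ≥ 2, and u = (u_1,…,u_d) ∈ (0,1)^d. Let ψ_θ(t) = 1 - (1-exp(-t))^α be the Joe generator with inverse ψ_θ^{-1}(u) = -log(1 - (1-u)^θ), set t_θ(u) = ∑_{j=1}^d ψ_θ^{-1}(u_j) and h^J_θ(u) = ∏_{j=1}^d (1 - (1-u_j)^θ); for 1 ≤ k ≤ d let S(d,k) = (1/k!)·∑_{l=0}^{k}(-1)^{k-l}·(k choose l)·l^d and a^J_{dk}(θ) = S(d,k)·∏_{m=1}^{k-1}(m - α). Then (-1)^d · ψ_θ^{(d)}(t_θ(u)) · ∏_{j=1}^d (-(ψ_θ^{-1})'(u_j)) = θ^{d-1} · (∏_{j=1}^d (1-u_j)^{θ-1}) / (1 - h^J_θ(u))^{1-1/θ} · ∑_{k=1}^{d} a^J_{dk}(θ) · (h^J_θ(u)/(1 - h^J_θ(u)))^{k-1}. -/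
open Finset in
theorem sum_alternating_choose_mul_pow_succ (n k : ℕ) :
    ∑ l ∈ range (k + 2), (-1 : ℝ) ^ (k + 1 - l) * ((k + 1).choose l : ℝ) * (l : ℝ) ^ (n + 1) =
      (k + 1) * (∑ l ∈ range (k + 2), (-1 : ℝ) ^ (k + 1 - l) * ((k + 1).choose l : ℝ) * (l : ℝ) ^ n
        + ∑ l ∈ range (k + 1), (-1 : ℝ) ^ (k - l) * (k.choose l : ℝ) * (l : ℝ) ^ n) := by
  have hext : ∑ l ∈ range (k + 1), (-1 : ℝ) ^ (k - l) * (k.choose l : ℝ) * (l : ℝ) ^ n =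
      ∑ l ∈ range (k + 2), -((-1 : ℝ) ^ (k + 1 - l) * (k.choose l : ℝ) * (l : ℝ) ^ n) := by
    rw [sum_range_succ _ (k + 1)]
    simp only [Nat.choose_succ_self, Nat.cast_zero, mul_zero, zero_mul, neg_zero, add_zero]
    refine sum_congr rfl fun l hl => ?_
    rw [Nat.succ_sub (Nat.lt_succ_iff.mp (mem_range.mp hl)), pow_succ]
    ring
  rw [hext, ← sum_add_distrib, mul_sum]
  refine sum_congr rfl fun l _ => ?_
  have habs : ((k + 1).choose l : ℝ) * l = (k + 1) * ((k + 1).choose l - k.choose l) := by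
    cases l with
    | zero => simp
    | succ l =>
      have h₁ := Nat.add_one_mul_choose_eq k l
      have h₂ := Nat.choose_succ_succ' k l
      rw [← Nat.cast_inj (R := ℝ)] at h₁ h₂
      push_cast at h₁ h₂ ⊢
      rw [← h₁, h₂]
      ring
  linear_combination (-1 : ℝ) ^ (k + 1 - l) * (l : ℝ) ^ n * habs

open Finset in
/-- The explicit alternating sum for the Stirling numbers of the second kind. -/
theorem Nat.cast_stirlingSecond_eq_sum (n k : ℕ) :
    (Nat.stirlingSecond n k : ℝ) = (1 / (k.factorial : ℝ)) *
      ∑ l ∈ range (k + 1), (-1 : ℝ) ^ (k - l) * (k.choose l : ℝ) * (l : ℝ) ^ n := by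
  induction n generalizing k with
  | zero =>
    have hbin := add_pow (1 : ℝ) (-1) k
    simp only [one_pow, one_mul, add_neg_cancel] at hbin
    simp only [pow_zero, mul_one, ← hbin]
    cases k <;> simp
  | succ n ih =>
    cases k with
    | zero => simp
    | succ k =>
      rw [sum_alternating_choose_mul_pow_succ, Nat.stirlingSecond_succ_succ, Nat.cast_add,
        Nat.cast_mul, ih, ih, Nat.factorial_succ]
      have : (k.factorial : ℝ) ≠ 0 := by positivity
      have : (k : ℝ) + 1 ≠ 0 := by positivity
      push_cast
      field_simp

/-- The basis functions `∏_{m=1}^{j} (m - α) · e^{-(j+1)t} (1 - e^{-t})^{α-(j+1)}` in which the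
derivatives of the Joe generator are expanded. -/
noncomputable def joeBasis (α : ℝ) (j : ℕ) (t : ℝ) : ℝ :=
  (∏ m ∈ Finset.range j, ((m : ℝ) + 1 - α)) * Real.exp (-t) ^ (j + 1) *
    (1 - Real.exp (-t)) ^ (α - (j + 1))

theorem hasDerivAt_one_sub_exp_neg_rpow (β : ℝ) {t : ℝ} (ht : 0 < t) :
    HasDerivAt (fun s => (1 - Real.exp (-s)) ^ β)
      (β * Real.exp (-t) * (1 - Real.exp (-t)) ^ (β - 1)) t := by
  have hpos : 0 < 1 - Real.exp (-t) := by simpa using ht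
  have h := (((hasDerivAt_neg t).exp).const_sub 1).rpow_const (p := β) (Or.inl hpos.ne')
  convert h using 1
  ring

theorem hasDerivAt_joeBasis (α : ℝ) (j : ℕ) {t : ℝ} (ht : 0 < t) :
    HasDerivAt (joeBasis α j) (-((j + 1) * joeBasis α j t + joeBasis α (j + 1) t)) t := by
  have hexp := ((hasDerivAt_neg t).exp.fun_pow (j + 1)).const_mul
    (∏ m ∈ Finset.range j, ((m : ℝ) + 1 - α))
  have h := hexp.mul (hasDerivAt_one_sub_exp_neg_rpow (α - (j + 1)) ht)
  refine h.congr_deriv ?_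
  simp only [joeBasis, Finset.prod_range_succ]
  push_cast
  rw [show α - ((j : ℝ) + 1 + 1) = α - (j + 1) - 1 by ring]
  ring

open Finset in
theorem iteratedDeriv_joe_generator (α : ℝ) (n : ℕ) {t : ℝ} (ht : 0 < t) :
    iteratedDeriv (n + 1) (fun s => 1 - (1 - Real.exp (-s)) ^ α) t =
      (-1) ^ (n + 1) * α *
        ∑ j ∈ range (n + 1), (Nat.stirlingSecond (n + 1) (j + 1) : ℝ) * joeBasis α j t := by
  induction n generalizing t with
  | zero =>
    rw [zero_add, iteratedDeriv_one, ((hasDerivAt_one_sub_exp_neg_rpow α ht).const_sub 1).deriv]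
    simp [joeBasis, Nat.stirlingSecond_one_right 0]
    ring
  | succ n ih =>
    have hev : iteratedDeriv (n + 1) (fun s => 1 - (1 - Real.exp (-s)) ^ α) =ᶠ[nhds t]
        fun s => (-1) ^ (n + 1) * α *
          ∑ j ∈ range (n + 1), (Nat.stirlingSecond (n + 1) (j + 1) : ℝ) * joeBasis α j s :=
      (eventually_gt_nhds ht).mono fun s hs => ih hs
    have hderiv := (HasDerivAt.fun_sum (u := range (n + 1)) fun j _ =>
      (hasDerivAt_joeBasis α j ht).const_mul
        (Nat.stirlingSecond (n + 1) (j + 1) : ℝ)).const_mul ((-1) ^ (n + 1) * α)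
    rw [iteratedDeriv_succ, hev.deriv_eq, hderiv.deriv, pow_succ _ (n + 1)]
    have hsum : ∑ j ∈ range (n + 2),
          (Nat.stirlingSecond (n + 2) (j + 1) : ℝ) * joeBasis α j t =
        ∑ j ∈ range (n + 1), (Nat.stirlingSecond (n + 1) (j + 1) : ℝ) *
          ((j + 1) * joeBasis α j t + joeBasis α (j + 1) t) := by
      simp only [Nat.stirlingSecond_succ_succ (n + 1), Nat.cast_add, Nat.cast_mul,
        add_mul _ _ (joeBasis _ _ _), mul_add (Nat.cast (Nat.stirlingSecond _ _)), sum_add_distrib]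
      congr 1
      · rw [sum_range_succ, Nat.stirlingSecond_eq_zero_of_lt (Nat.lt_succ_self (n + 1))]
        simp only [Nat.cast_add, Nat.cast_one, Nat.cast_zero, mul_zero, zero_mul, add_zero,
          ← sum_add_distrib]
        exact sum_congr rfl fun j _ => by ring
      · rw [sum_range_succ']
        simp
    rw [hsum]
    simp only [mul_neg, sum_neg_distrib]
    ring

/-- The derivative of the inverse Joe generator. -/
theorem hasDerivAt_joe_generator_inv (θ : ℝ) {v : ℝ} (hv : v < 1) (hne : 1 - (1 - v) ^ θ ≠ 0) :
    HasDerivAt (fun v => -Real.log (1 - (1 - v) ^ θ))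
      (-(θ * (1 - v) ^ (θ - 1) / (1 - (1 - v) ^ θ))) v := by
  have h := (((((hasDerivAt_id' v).const_sub 1).rpow_const (p := θ)
    (Or.inl (sub_pos.mpr hv).ne')).const_sub 1).log hne).fun_neg
  refine h.congr_deriv ?_
  ring

theorem joeBasis_eq (α : ℝ) (j : ℕ) {t : ℝ} (ht : 0 < t) :
    joeBasis α j t = Real.exp (-t) * (1 - Real.exp (-t)) ^ (α - 1) *
      ((∏ m ∈ Finset.Icc 1 j, ((m : ℝ) - α)) * (Real.exp (-t) / (1 - Real.exp (-t))) ^ j) := by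
  have hpos : 0 < 1 - Real.exp (-t) := by simpa using ht
  have hprod : ∏ m ∈ Finset.Icc 1 j, ((m : ℝ) - α) =
      ∏ m ∈ Finset.range j, ((m : ℝ) + 1 - α) := by
    rw [← Finset.Ico_succ_right_eq_Icc, Finset.prod_Ico_eq_prod_range]
    simp [add_comm]
  rw [joeBasis, hprod, show α - ((j : ℝ) + 1) = α - 1 - j by ring, Real.rpow_sub hpos,
    Real.rpow_natCast, div_pow, pow_succ]
  ring


/-- Closed form of the d-dimensional Joe copula density: with
`ψ_θ(t) = 1-(1-e^{-t})^α`, `α = 1/θ`, `ψ_θ^{-1}(u) = -log(1-(1-u)^θ)`,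
`t_θ(u) = ∑_j ψ_θ^{-1}(u_j)`, `h^J_θ(u) = ∏_j (1-(1-u_j)^θ)` and
`a^J_{dk}(θ) = S(d,k) ∏_{m=1}^{k-1}(m-α)` with `S(d,k)` the Stirling number of
the second kind, one has
`(-1)^d ψ_θ^{(d)}(t_θ(u)) ∏_j (-(ψ_θ^{-1})'(u_j))
   = θ^{d-1} (∏_j (1-u_j)^{θ-1}) / (1-h^J_θ(u))^{1-1/θ}
       · ∑_{k=1}^d a^J_{dk}(θ) (h^J_θ(u)/(1-h^J_θ(u)))^{k-1}`. -/
theorem joe_copula_density (θ : ℝ) (hθ : 1 ≤ θ) (α : ℝ) (hα : α = 1 / θ)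
    (d : ℕ) (hd : 2 ≤ d) (u : Fin d → ℝ) (hu : ∀ j, u j ∈ Set.Ioo (0 : ℝ) 1)
    (ψ ψinv : ℝ → ℝ)
    (hψ : ∀ t : ℝ, ψ t = 1 - (1 - Real.exp (-t)) ^ α)
    (hψinv : ∀ v : ℝ, ψinv v = -Real.log (1 - (1 - v) ^ θ))
    (t h : ℝ)
    (ht : t = ∑ j, ψinv (u j))
    (hh : h = ∏ j, (1 - (1 - u j) ^ θ))
    (S : ℕ → ℕ → ℝ)
    (hS : ∀ d' k : ℕ, S d' k = (1 / (Nat.factorial k : ℝ)) *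
        ∑ l ∈ Finset.range (k + 1),
          (-1 : ℝ) ^ (k - l) * (Nat.choose k l : ℝ) * (l : ℝ) ^ d')
    (a : ℕ → ℝ)
    (ha : ∀ k : ℕ, a k = S d k * ∏ m ∈ Finset.Icc 1 (k - 1), ((m : ℝ) - α)) :
    (-1 : ℝ) ^ d * iteratedDeriv d ψ t * ∏ j, (-(deriv ψinv (u j))) =
      θ ^ (d - 1) * (∏ j, (1 - u j) ^ (θ - 1)) / (1 - h) ^ ((1 : ℝ) - 1 / θ) *
        ∑ k ∈ Finset.Icc 1 d, a k * (h / (1 - h)) ^ (k - 1) := by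
  have hθ0 : 0 < θ := by linarith
  have hfac : ∀ j, 0 < 1 - (1 - u j) ^ θ ∧ 1 - (1 - u j) ^ θ < 1 := fun j => by
    obtain ⟨h0, h1⟩ := hu j
    have hp := Real.rpow_pos_of_pos (sub_pos.mpr h1) θ
    have hl := Real.rpow_lt_one (sub_pos.mpr h1).le (by linarith) hθ0
    constructor <;> linarith
  have hexp : Real.exp (-t) = h := by
    rw [ht, hh, ← Finset.sum_neg_distrib, Real.exp_sum]
    refine Finset.prod_congr rfl fun j _ => ?_
    rw [hψinv, neg_neg, Real.exp_log (hfac j).1]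
  have ht0 : 0 < t := by
    rw [ht]
    refine Finset.sum_pos (fun j _ => ?_) ⟨⟨0, by omega⟩, Finset.mem_univ _⟩
    rw [hψinv]
    exact neg_pos.mpr (Real.log_neg (hfac j).1 (hfac j).2)
  have hh0 : 0 < h := hexp ▸ Real.exp_pos _
  have hh1 : 0 < 1 - h := by
    rw [← hexp]
    simpa using ht0
  have hinv : ∏ j, (-(deriv ψinv (u j))) = θ ^ d * (∏ j, (1 - u j) ^ (θ - 1)) / h := by
    rw [hh, funext hψinv]
    simp only [fun j => (hasDerivAt_joe_generator_inv θ (hu j).2 (hfac j).1.ne').deriv, neg_neg,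
      Finset.prod_div_distrib, Finset.prod_mul_distrib, Finset.prod_const, Finset.card_univ,
      Fintype.card_fin]
  obtain ⟨n, rfl⟩ : ∃ n, d = n + 1 := ⟨d - 1, by omega⟩
  have hsum : ∑ k ∈ Finset.Icc 1 (n + 1), a k * (h / (1 - h)) ^ (k - 1) =
      ∑ j ∈ Finset.range (n + 1), (Nat.stirlingSecond (n + 1) (j + 1) : ℝ) *
        ((∏ m ∈ Finset.Icc 1 j, ((m : ℝ) - α)) * (h / (1 - h)) ^ j) := by
    rw [← Finset.Ico_succ_right_eq_Icc, Finset.sum_Ico_eq_sum_range]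
    refine Finset.sum_congr rfl fun j _ => ?_
    rw [add_comm 1 j, ha, hS, ← Nat.cast_stirlingSecond_eq_sum, Nat.add_sub_cancel, mul_assoc]
  have hgen : iteratedDeriv (n + 1) ψ t = (-1) ^ (n + 1) * α * (h * (1 - h) ^ (α - 1) *
      ∑ k ∈ Finset.Icc 1 (n + 1), a k * (h / (1 - h)) ^ (k - 1)) := by
    rw [funext hψ, iteratedDeriv_joe_generator α n ht0, hsum, Finset.mul_sum (a := h * _)]
    simp only [joeBasis_eq α _ ht0, hexp, mul_left_comm]
  have hsign : (-1 : ℝ) ^ (n + 1) * (-1) ^ (n + 1) = 1 := by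
    rw [← mul_pow]
    simp
  rw [hgen, hinv, ← hα, show α - 1 = -(1 - α) by ring, Real.rpow_neg hh1.le, Nat.add_sub_cancel]
  generalize ∑ k ∈ Finset.Icc 1 (n + 1), a k * (h / (1 - h)) ^ (k - 1) = s
  have hαθ : α * θ = 1 := by rw [hα, one_div, inv_mul_cancel₀ hθ0.ne']
  have hhh : h * h⁻¹ = 1 := mul_inv_cancel₀ hh0.ne'
  calc _ = ((-1 : ℝ) ^ (n + 1) * (-1) ^ (n + 1)) * (α * θ) * (h * h⁻¹) *
        (θ ^ n * (∏ j, (1 - u j) ^ (θ - 1)) / (1 - h) ^ (1 - α) * s) := by ring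
    _ = _ := by rw [hsign, hαθ, hhh, one_mul, one_mul, one_mul]
end

section
/- Let d ∈ ℕ with d ≥ 2 and u = (u_1,…,u_d) ∈ (0,1)^d. For θ ∈ (0,1) define the Ali-Mikhail-Haq copula density in closed form by c_θ(u) = ((1-θ)^{d+1}/θ^2) · (h^A_θ(u)/∏_{j=1}^d u_j^2) · ∑_{k=1}^∞ k^d·h^A_θ(u)^k with h^A_θ(u) = θ·∏_{j=1}^d u_j/(1-θ(1-u_j)), and b^A_θ(u) = ∑_{j=1}^d (1-u_j)/(1-θ(1-u_j)). Then the derivative with respect to θ of the map θ ↦ log c_θ(u) at any θ ∈ (0,1) equals -(d+1)/(1-θ) - 1/θ + b^A_θ(u) + (b^A_θ(u) + 1/θ) · (∑_{k=1}^∞ k^{d+1}·h^A_θ(u)^k)/(∑_{k=1}^∞ k^d·h^A_θ(u)^k). -/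
theorem summable_succ_pow_mul_geometric (m : ℕ) {r : ℝ} (hr0 : 0 < r) (hr1 : r < 1) :
    Summable fun k : ℕ => ((k : ℝ) + 1) ^ m * r ^ k := by
  have h := (summable_nat_add_iff 1).2
    (summable_pow_mul_geometric_of_norm_lt_one m (r := r) (by rwa [Real.norm_of_nonneg hr0.le]))
  refine (h.mul_left r⁻¹).congr fun k => ?_
  push_cast
  field_simp
  ring

theorem summable_succ_pow_mul_geometric_succ (m : ℕ) {r : ℝ} (hr0 : 0 < r) (hr1 : r < 1) :
    Summable fun k : ℕ => ((k : ℝ) + 1) ^ m * r ^ (k + 1) :=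
  ((summable_succ_pow_mul_geometric m hr0 hr1).mul_left r).congr fun k => by ring

theorem tsum_succ_pow_mul_geometric_succ_pos (m : ℕ) {r : ℝ} (hr0 : 0 < r) (hr1 : r < 1) :
    0 < ∑' k : ℕ, ((k : ℝ) + 1) ^ m * r ^ (k + 1) :=
  (summable_succ_pow_mul_geometric_succ m hr0 hr1).tsum_pos (fun k => by positivity) 0
    (by positivity)

/-- The derivative of the polylogarithm `Li_{-m}` on `(0, 1)` is `z ↦ Li_{-(m+1)}(z) / z`. -/
theorem hasDerivAt_tsum_succ_pow_mul_geometric_succ (m : ℕ) {z : ℝ} (hz0 : 0 < z) (hz1 : z < 1) :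
    HasDerivAt (fun y : ℝ => ∑' k : ℕ, ((k : ℝ) + 1) ^ m * y ^ (k + 1))
      ((∑' k : ℕ, ((k : ℝ) + 1) ^ (m + 1) * z ^ (k + 1)) / z) z := by
  obtain ⟨r, hzr, hr1⟩ := exists_between hz1
  have h := hasDerivAt_tsum_of_isPreconnected (t := Set.Ioo 0 r) (y₀ := z)
    (g := fun (k : ℕ) (y : ℝ) => ((k : ℝ) + 1) ^ m * y ^ (k + 1))
    (g' := fun (k : ℕ) (y : ℝ) => ((k : ℝ) + 1) ^ (m + 1) * y ^ k)
    (summable_succ_pow_mul_geometric (m + 1) (hz0.trans hzr) hr1) isOpen_Ioo isPreconnected_Ioo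
    (fun k y _ => by
      refine ((hasDerivAt_pow (k + 1) y).const_mul (((k : ℝ) + 1) ^ m)).congr_deriv ?_
      push_cast
      ring)
    (fun k y hy => by
      have hy0 := hy.1.le
      rw [Real.norm_of_nonneg (by positivity)]
      gcongr
      exact hy.2.le)
    ⟨hz0, hzr⟩ (summable_succ_pow_mul_geometric_succ m hz0 hz1) ⟨hz0, hzr⟩
  refine h.congr_deriv ?_
  rw [← tsum_div_const]
  refine tsum_congr fun k => ?_
  rw [pow_succ z k, ← mul_assoc, mul_div_cancel_right₀ _ hz0.ne']

theorem one_sub_mul_one_sub_pos {θ x : ℝ} (hθ : θ ∈ Set.Ioo (0 : ℝ) 1)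
    (hx : x ∈ Set.Ioo (0 : ℝ) 1) : 0 < 1 - θ * (1 - x) := by
  nlinarith [mul_pos hθ.1 hx.1, hθ.2]

theorem mul_prod_div_mem_Ioo {ι : Type*} [Fintype ι] {u : ι → ℝ}
    (hu : ∀ j, u j ∈ Set.Ioo (0 : ℝ) 1) {θ : ℝ} (hθ : θ ∈ Set.Ioo (0 : ℝ) 1) :
    θ * ∏ j, u j / (1 - θ * (1 - u j)) ∈ Set.Ioo (0 : ℝ) 1 := by
  have hq : ∀ j, 0 < u j / (1 - θ * (1 - u j)) := fun j =>
    div_pos (hu j).1 (one_sub_mul_one_sub_pos hθ (hu j))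
  have hle : ∏ j, u j / (1 - θ * (1 - u j)) ≤ 1 :=
    Finset.prod_le_one (fun j _ => (hq j).le) fun j _ => by
      rw [div_le_one (one_sub_mul_one_sub_pos hθ (hu j))]
      nlinarith [mul_pos (sub_pos.2 hθ.2) (sub_pos.2 (hu j).2)]
  exact ⟨mul_pos hθ.1 (Finset.prod_pos fun j _ => hq j),
    (mul_le_of_le_one_right hθ.1.le hle).trans_lt hθ.2⟩

theorem hasDerivAt_mul_prod_div {ι : Type*} [Fintype ι] {u : ι → ℝ}
    (hu : ∀ j, u j ∈ Set.Ioo (0 : ℝ) 1) {θ : ℝ} (hθ : θ ∈ Set.Ioo (0 : ℝ) 1) :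
    HasDerivAt (fun ϑ : ℝ => ϑ * ∏ j, u j / (1 - ϑ * (1 - u j)))
      ((θ * ∏ j, u j / (1 - θ * (1 - u j))) *
        (∑ j, (1 - u j) / (1 - θ * (1 - u j)) + 1 / θ)) θ := by
  have key : ∀ ϑ ∈ Set.Ioo (0 : ℝ) 1, ϑ * ∏ j, u j / (1 - ϑ * (1 - u j)) =
      Real.exp (∑ j, (Real.log (u j) - Real.log (1 - ϑ * (1 - u j))) + Real.log ϑ) := by
    intro ϑ hϑ
    rw [Real.exp_add, Real.exp_log hϑ.1, Real.exp_sum, mul_comm]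
    congr 1
    refine Finset.prod_congr rfl fun j _ => ?_
    rw [Real.exp_sub, Real.exp_log (hu j).1, Real.exp_log (one_sub_mul_one_sub_pos hϑ (hu j))]
  have hterm : ∀ j ∈ Finset.univ,
      HasDerivAt (fun ϑ : ℝ => Real.log (u j) - Real.log (1 - ϑ * (1 - u j)))
        ((1 - u j) / (1 - θ * (1 - u j))) θ := fun j _ => by
    refine (((((hasDerivAt_id' θ).mul_const (1 - u j)).const_sub 1).log
      (one_sub_mul_one_sub_pos hθ (hu j)).ne').const_sub (Real.log (u j))).congr_deriv ?_
    ring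
  have h := ((HasDerivAt.fun_sum hterm).fun_add (Real.hasDerivAt_log hθ.1.ne')).exp
  rw [← key θ hθ, ← one_div] at h
  exact h.congr_of_eventuallyEq (Filter.eventuallyEq_of_mem (isOpen_Ioo.mem_nhds hθ) key)

/-- Score function of the Ali-Mikhail-Haq family: with
`h^A_θ(u) = θ ∏_j u_j/(1-θ(1-u_j))`,
`c_θ(u) = ((1-θ)^{d+1}/θ^2)(h^A_θ(u)/∏_j u_j^2) Li_{-d}(h^A_θ(u))` and
`b^A_θ(u) = ∑_j (1-u_j)/(1-θ(1-u_j))`, the θ-derivative of `θ ↦ log c_θ(u)` at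
`θ ∈ (0,1)` equals
`-(d+1)/(1-θ) - 1/θ + b^A_θ(u) + (b^A_θ(u) + 1/θ) Li_{-(d+1)}(h^A_θ(u))/Li_{-d}(h^A_θ(u))`. -/
theorem amh_score (d : ℕ) (hd : 2 ≤ d) (u : Fin d → ℝ)
    (hu : ∀ j, u j ∈ Set.Ioo (0 : ℝ) 1)
    (hA c bA : ℝ → ℝ)
    (hhA : ∀ θ : ℝ, hA θ = θ * ∏ j, u j / (1 - θ * (1 - u j)))
    (hc : ∀ θ : ℝ, c θ = ((1 - θ) ^ (d + 1) / θ ^ 2) * (hA θ / ∏ j, (u j) ^ 2) *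
        ∑' k : ℕ, ((k : ℝ) + 1) ^ d * (hA θ) ^ (k + 1))
    (hbA : ∀ θ : ℝ, bA θ = ∑ j, (1 - u j) / (1 - θ * (1 - u j))) :
    ∀ θ : ℝ, θ ∈ Set.Ioo (0 : ℝ) 1 →
      deriv (fun ϑ => Real.log (c ϑ)) θ =
        -((d : ℝ) + 1) / (1 - θ) - 1 / θ + bA θ +
          (bA θ + 1 / θ) *
            (∑' k : ℕ, ((k : ℝ) + 1) ^ (d + 1) * (hA θ) ^ (k + 1)) /
            (∑' k : ℕ, ((k : ℝ) + 1) ^ d * (hA θ) ^ (k + 1)) := by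
  intro θ hθ
  have hmem : ∀ ϑ ∈ Set.Ioo (0 : ℝ) 1, hA ϑ ∈ Set.Ioo (0 : ℝ) 1 := fun ϑ hϑ => by
    rw [hhA]
    exact mul_prod_div_mem_Ioo hu hϑ
  have hder : HasDerivAt hA (hA θ * (bA θ + 1 / θ)) θ := by
    rw [hhA θ, hbA θ, funext hhA]
    exact hasDerivAt_mul_prod_div hu hθ
  have hP : 0 < ∏ j, (u j) ^ 2 := Finset.prod_pos fun j _ => pow_pos (hu j).1 2
  let L : ℝ → ℝ := fun y => ∑' k : ℕ, ((k : ℝ) + 1) ^ d * y ^ (k + 1)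
  have hLpos : ∀ ϑ ∈ Set.Ioo (0 : ℝ) 1, 0 < L (hA ϑ) := fun ϑ hϑ =>
    tsum_succ_pow_mul_geometric_succ_pos d (hmem ϑ hϑ).1 (hmem ϑ hϑ).2
  have hlog : ∀ ϑ ∈ Set.Ioo (0 : ℝ) 1, Real.log (c ϑ) =
      ((d : ℝ) + 1) * Real.log (1 - ϑ) - 2 * Real.log ϑ +
        (Real.log (hA ϑ) - Real.log (∏ j, (u j) ^ 2)) + Real.log (L (hA ϑ)) := by
    intro ϑ hϑ
    have h1 : 0 < 1 - ϑ := sub_pos.2 hϑ.2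
    have h0 := hϑ.1
    have hh := (hmem ϑ hϑ).1
    rw [hc ϑ, Real.log_mul (by positivity) (hLpos ϑ hϑ).ne',
      Real.log_mul (by positivity) (by positivity), Real.log_div (by positivity) (by positivity),
      Real.log_div hh.ne' hP.ne', Real.log_pow, Real.log_pow]
    push_cast
    rfl
  have hh := (hmem θ hθ).1
  have h1 : 0 < 1 - θ := sub_pos.2 hθ.2
  have h0 := hθ.1
  have hLθ := hLpos θ hθ
  have hLder := (hasDerivAt_tsum_succ_pow_mul_geometric_succ d hh (hmem θ hθ).2).comp θ hder
  have hsum := ((((((hasDerivAt_id' θ).const_sub 1).log h1.ne').const_mul ((d : ℝ) + 1)).fun_sub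
    ((Real.hasDerivAt_log h0.ne').const_mul 2)).fun_add
      ((hder.log hh.ne').sub_const (Real.log (∏ j, (u j) ^ 2)))).fun_add (hLder.log hLθ.ne')
  rw [(hsum.congr_of_eventuallyEq
    (Filter.eventuallyEq_of_mem (isOpen_Ioo.mem_nhds hθ) hlog)).deriv]
  change _ + _ / L (hA θ) = _ + _ / L (hA θ)
  field_simp
  ring
end

section
/- Let d ∈ ℕ with d ≥ 2 and u = (u_1,…,u_d) ∈ (0,1)^d. For θ > 0 define the Frank copula density in closed form by c_θ(u) = (θ/(1-e^{-θ}))^{d-1} · (∑_{k=1}^∞ k^{d-1}·h^F_θ(u)^k) · exp(-θ∑_{j=1}^d u_j)/h^F_θ(u) with h^F_θ(u) = (1-e^{-θ})^{1-d}·∏_{j=1}^d (1-exp(-θu_j)). Then the derivative with respect to θ of the map θ ↦ log c_θ(u) at any θ > 0 equals (d-1)/θ - ∑_{j=1}^d u_j/(1-exp(-θu_j)) + (∑_{j=1}^d u_j·exp(-θu_j)/(1-exp(-θu_j)) - (d-1)·e^{-θ}/(1-e^{-θ})) · (∑_{k=1}^∞ k^d·h^F_θ(u)^k)/(∑_{k=1}^∞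 k^{d-1}·h^F_θ(u)^k). -/
theorem summable_succ_pow_mul_pow (s : ℕ) {x : ℝ} (hx0 : 0 < x) (hx1 : x < 1) :
    Summable fun k : ℕ => ((k : ℝ) + 1) ^ s * x ^ (k + 1) := by
  have h : Summable fun k : ℕ => (k : ℝ) ^ s * x ^ k :=
    summable_pow_mul_geometric_of_norm_lt_one s (by rwa [Real.norm_of_nonneg hx0.le])
  have h' := (summable_nat_add_iff 1).mpr h
  push_cast at h'
  exact h'

/-- The polylogarithm series `Li_{-s}` can be differentiated termwise on the unit interval. -/
theorem hasDerivAt_tsum_succ_pow_mul_pow (s : ℕ) {x : ℝ} (hx0 : 0 < x) (hx1 : x < 1) :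
    HasDerivAt (fun y : ℝ => ∑' k : ℕ, ((k : ℝ) + 1) ^ s * y ^ (k + 1))
      ((∑' k : ℕ, ((k : ℝ) + 1) ^ (s + 1) * x ^ (k + 1)) / x) x := by
  obtain ⟨r, hxr, hr1⟩ := exists_between hx1
  have hr0 : 0 < r := hx0.trans hxr
  have hderiv := hasDerivAt_tsum_of_isPreconnected
    (g := fun (k : ℕ) (y : ℝ) => ((k : ℝ) + 1) ^ s * y ^ (k + 1))
    (g' := fun (k : ℕ) (y : ℝ) => ((k : ℝ) + 1) ^ (s + 1) * y ^ k)
    (u := fun k : ℕ => ((k : ℝ) + 1) ^ (s + 1) * r ^ (k + 1) / r)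
    (t := Set.Ioo (-r) r) (y₀ := x) (y := x)
    ((summable_succ_pow_mul_pow (s + 1) hr0 hr1).div_const r) isOpen_Ioo isPreconnected_Ioo
    ?_ ?_ ⟨by linarith, hxr⟩ (summable_succ_pow_mul_pow s hx0 hx1) ⟨by linarith, hxr⟩
  · refine hderiv.congr_deriv ?_
    rw [← tsum_div_const]
    refine tsum_congr fun k => ?_
    field_simp
    ring
  · intro k y _
    refine ((hasDerivAt_pow (k + 1) y).const_mul (((k : ℝ) + 1) ^ s)).congr_deriv ?_
    push_cast
    ring
  · intro k y hy
    have hyr : |y| ≤ r := (abs_lt.mpr hy).le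
    rw [norm_mul, norm_pow, norm_pow, Real.norm_eq_abs y,
      Real.norm_of_nonneg (by positivity : (0 : ℝ) ≤ (k : ℝ) + 1), pow_succ r k, ← mul_assoc,
      mul_div_cancel_right₀ _ hr0.ne']
    gcongr

theorem tsum_succ_pow_mul_pow_pos (s : ℕ) {x : ℝ} (hx0 : 0 < x) (hx1 : x < 1) :
    0 < ∑' k : ℕ, ((k : ℝ) + 1) ^ s * x ^ (k + 1) :=
  (summable_succ_pow_mul_pow s hx0 hx1).tsum_pos (fun k => by positivity) 0 (by positivity)

theorem one_sub_exp_neg_pos {t : ℝ} (ht : 0 < t) : 0 < 1 - Real.exp (-t) := by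
  simpa using ht

theorem hasDerivAt_log_one_sub_exp_neg_mul {a t : ℝ} (h : 0 < t * a) :
    HasDerivAt (fun y => Real.log (1 - Real.exp (-(y * a))))
      (a * Real.exp (-(t * a)) / (1 - Real.exp (-(t * a)))) t := by
  have hlin : HasDerivAt (fun y : ℝ => -(y * a)) (-a) t := by
    simpa using ((hasDerivAt_id t).mul_const a).fun_neg
  convert (hlin.exp.const_sub 1).log (one_sub_exp_neg_pos h).ne' using 1
  ring

/-- The Frank argument `h^F_θ(u)` lies below one. -/
theorem rpow_mul_prod_one_sub_exp_neg_lt_one {d : ℕ} {u : Fin d → ℝ}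
    (hu : ∀ j, u j ∈ Set.Ioo (0 : ℝ) 1) {t : ℝ} (ht : 0 < t) :
    (1 - Real.exp (-t)) ^ ((1 : ℝ) - (d : ℝ)) * ∏ j, (1 - Real.exp (-(t * u j))) < 1 := by
  have hE := one_sub_exp_neg_pos ht
  calc (1 - Real.exp (-t)) ^ ((1 : ℝ) - (d : ℝ)) * ∏ j, (1 - Real.exp (-(t * u j)))
      ≤ (1 - Real.exp (-t)) ^ ((1 : ℝ) - (d : ℝ)) * ∏ _j : Fin d, (1 - Real.exp (-t)) := by
        gcongr with j _
        · exact fun j _ => (one_sub_exp_neg_pos (mul_pos ht (hu j).1)).le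
        · exact mul_le_of_le_one_right ht.le (hu j).2.le
    _ = 1 - Real.exp (-t) := by
        rw [Finset.prod_const, Finset.card_univ, Fintype.card_fin, ← Real.rpow_natCast,
          ← Real.rpow_add hE]
        simp
    _ < 1 := by linarith [Real.exp_pos (-t)]

/-- Score function of the Frank family: with
`h^F_θ(u) = (1-e^{-θ})^{1-d} ∏_j (1-e^{-θu_j})` and
`c_θ(u) = (θ/(1-e^{-θ}))^{d-1} Li_{-(d-1)}(h^F_θ(u)) exp(-θ ∑_j u_j)/h^F_θ(u)`,
the θ-derivative of `θ ↦ log c_θ(u)` at `θ > 0` equals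
`(d-1)/θ - ∑_j u_j/(1-e^{-θu_j})
  + (∑_j u_j e^{-θu_j}/(1-e^{-θu_j}) - (d-1)e^{-θ}/(1-e^{-θ}))
      · Li_{-d}(h^F_θ(u))/Li_{-(d-1)}(h^F_θ(u))`. -/
theorem frank_score (d : ℕ) (hd : 2 ≤ d) (u : Fin d → ℝ)
    (hu : ∀ j, u j ∈ Set.Ioo (0 : ℝ) 1)
    (hF c : ℝ → ℝ)
    (hhF : ∀ θ : ℝ, hF θ = (1 - Real.exp (-θ)) ^ ((1 : ℝ) - (d : ℝ)) *
        ∏ j, (1 - Real.exp (-(θ * u j))))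
    (hc : ∀ θ : ℝ, c θ = (θ / (1 - Real.exp (-θ))) ^ (d - 1) *
        (∑' k : ℕ, ((k : ℝ) + 1) ^ (d - 1) * (hF θ) ^ (k + 1)) *
        Real.exp (-(θ * ∑ j, u j)) / hF θ) :
    ∀ θ : ℝ, 0 < θ →
      deriv (fun ϑ => Real.log (c ϑ)) θ =
        ((d : ℝ) - 1) / θ - (∑ j, u j / (1 - Real.exp (-(θ * u j)))) +
          ((∑ j, u j * Real.exp (-(θ * u j)) / (1 - Real.exp (-(θ * u j)))) -
              ((d : ℝ) - 1) * Real.exp (-θ) / (1 - Real.exp (-θ))) *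
            (∑' k : ℕ, ((k : ℝ) + 1) ^ d * (hF θ) ^ (k + 1)) /
            (∑' k : ℕ, ((k : ℝ) + 1) ^ (d - 1) * (hF θ) ^ (k + 1)) := by
  intro θ hθ
  have hpos {t : ℝ} (ht : 0 < t) : 0 < hF t := by
    rw [hhF]
    exact mul_pos (Real.rpow_pos_of_pos (one_sub_exp_neg_pos ht) _)
      (Finset.prod_pos fun j _ => one_sub_exp_neg_pos (mul_pos ht (hu j).1))
  have hlt {t : ℝ} (ht : 0 < t) : hF t < 1 := by
    rw [hhF]
    exact rpow_mul_prod_one_sub_exp_neg_lt_one hu ht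
  have hcast : ((d - 1 : ℕ) : ℝ) = (d : ℝ) - 1 := by
    rw [Nat.cast_sub (by lia), Nat.cast_one]
  set A : ℝ := (∑ j, u j * Real.exp (-(θ * u j)) / (1 - Real.exp (-(θ * u j)))) -
    ((d : ℝ) - 1) * Real.exp (-θ) / (1 - Real.exp (-θ)) with hA
  have hlogE : HasDerivAt (fun t => Real.log (1 - Real.exp (-t)))
      (Real.exp (-θ) / (1 - Real.exp (-θ))) θ := by
    simpa using hasDerivAt_log_one_sub_exp_neg_mul (a := 1) (t := θ) (by simpa using hθ)
  have hlogF : HasDerivAt (fun t => Real.log (hF t)) A θ := by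
    have h := (hlogE.const_mul ((1 : ℝ) - d)).add
      (HasDerivAt.fun_sum (u := Finset.univ) fun j _ =>
        hasDerivAt_log_one_sub_exp_neg_mul (mul_pos hθ (hu j).1))
    refine (h.congr_of_eventuallyEq ?_).congr_deriv (by rw [hA]; ring)
    filter_upwards [eventually_gt_nhds hθ] with t ht
    have hE := one_sub_exp_neg_pos ht
    have hP (j : Fin d) := (one_sub_exp_neg_pos (mul_pos ht (hu j).1)).ne'
    rw [hhF, Real.log_mul (Real.rpow_pos_of_pos hE _).ne' (Finset.prod_ne_zero_iff.mpr
      fun j _ => hP j), Real.log_rpow hE, Real.log_prod fun j _ => hP j]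
    rfl
  have hderivF : HasDerivAt hF (hF θ * A) θ := by
    have h := hlogF.exp
    rw [Real.exp_log (hpos hθ)] at h
    refine h.congr_of_eventuallyEq ?_
    filter_upwards [eventually_gt_nhds hθ] with t ht
    exact (Real.exp_log (hpos ht)).symm
  have hL := tsum_succ_pow_mul_pow_pos (d - 1) (hpos hθ) (hlt hθ)
  have hlogL := ((hasDerivAt_tsum_succ_pow_mul_pow (d - 1) (hpos hθ) (hlt hθ)).comp θ
    hderivF).log hL.ne'
  have hlogc := (((((Real.hasDerivAt_log hθ.ne').sub hlogE).const_mul ((d : ℝ) - 1)).add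
    hlogL).sub ((hasDerivAt_id θ).mul_const (∑ j, u j))).sub hlogF
  have hlogc_eq : (fun t => Real.log (c t)) =ᶠ[nhds θ] fun t =>
      ((d : ℝ) - 1) * (Real.log t - Real.log (1 - Real.exp (-t))) +
        Real.log (∑' k : ℕ, ((k : ℝ) + 1) ^ (d - 1) * hF t ^ (k + 1)) - t * ∑ j, u j -
        Real.log (hF t) := by
    filter_upwards [eventually_gt_nhds hθ] with t ht
    have hE := (one_sub_exp_neg_pos ht).ne'
    have hLt := (tsum_succ_pow_mul_pow_pos (d - 1) (hpos ht) (hlt ht)).ne'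
    have hpow : (t / (1 - Real.exp (-t))) ^ (d - 1) ≠ 0 := pow_ne_zero _ (div_ne_zero ht.ne' hE)
    rw [hc, Real.log_div (mul_ne_zero (mul_ne_zero hpow hLt) (Real.exp_ne_zero _)) (hpos ht).ne',
      Real.log_mul (mul_ne_zero hpow hLt) (Real.exp_ne_zero _), Real.log_mul hpow hLt,
      Real.log_pow, Real.log_div ht.ne' hE, Real.log_exp, hcast]
    ring
  have hsplit : ∑ j, u j / (1 - Real.exp (-(θ * u j))) =
      ∑ j, u j + ∑ j, u j * Real.exp (-(θ * u j)) / (1 - Real.exp (-(θ * u j))) := by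
    rw [← Finset.sum_add_distrib]
    refine Finset.sum_congr rfl fun j _ => ?_
    have hj := (one_sub_exp_neg_pos (mul_pos hθ (hu j).1)).ne'
    rw [div_eq_iff hj, add_mul, div_mul_cancel₀ _ hj]
    ring
  have hratio (S T : ℝ) : S / hF θ * (hF θ * A) / T = A * S / T := by
    rw [← mul_assoc, div_mul_cancel₀ _ (hpos hθ).ne', mul_comm]
  rw [(hlogc.congr_of_eventuallyEq hlogc_eq).deriv, hsplit, Function.comp_apply, hratio,
    Nat.sub_add_cancel (by lia)]
  linear_combination -hA
end
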